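/- arXiv:0903.5056 — 4 statements merged into one kernel-verified Lean document; each statement's English description precedes it below -/
import Mathlib

section
/- For all integers k, l ∈ ℤ, the function t ↦ I_{k+2,l+1}(t) − I_{k+3,l+1}(t) − 2·I_{k+2,l+2}(t) is differentiable on (0, 1/64) and its derivative at each t ∈ (0, 1/64) equals (l+1)·I_{k,l}(t). In particular, for l = 0: the derivative of t ↦ I_{k+2,1}(t) − I_{k+3,1}(t) − 2·I_{k+2,2}(t) equals I_{k,0}(t). -/
open MeasureTheory Set Filter

/-- The region bounded by the real oval of `{x^2 y (1-x-y) = t}` in the first quadrant. -/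
def Δset (t : ℝ) : Set (ℝ × ℝ) :=
  {z : ℝ × ℝ | 0 < z.1 ∧ 0 < z.2 ∧ t ≤ z.1 ^ 2 * z.2 * (1 - z.1 - z.2)}

/-- The Abelian integral `I_{i,j}(t) = ∬_{Δ(t)} x^i y^j dx dy` (integer powers). -/
noncomputable def Iab (i j : ℤ) (t : ℝ) : ℝ :=
  ∫ z in Δset t, z.1 ^ i * z.2 ^ j

noncomputable def J1 (t : ℝ) : ℝ := Iab 0 0 t
noncomputable def J2 (t : ℝ) : ℝ := Iab 2 0 t
noncomputable def J3 (t : ℝ) : ℝ := Iab 3 0 t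

theorem isCompact_Δset {s : ℝ} (hs : 0 < s) : IsCompact (Δset s) := by
  have heq : Δset s = (Icc 0 1 ×ˢ Icc 0 1) ∩
      {z : ℝ × ℝ | s ≤ z.1 ^ 2 * z.2 * (1 - z.1 - z.2)} := by
    ext ⟨x, y⟩
    simp only [Δset, mem_ofPred_eq, mem_inter_iff, mem_prod, mem_Icc]
    constructor
    · rintro ⟨hx, hy, h⟩
      have hu : 0 < 1 - x - y :=
        pos_of_mul_pos_right (hs.trans_le h) (by positivity)
      exact ⟨⟨⟨hx.le, by linarith⟩, hy.le, by linarith⟩, h⟩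
    · rintro ⟨⟨⟨hx, -⟩, hy, -⟩, h⟩
      refine ⟨hx.lt_of_ne ?_, hy.lt_of_ne ?_, h⟩
      · rintro rfl
        norm_num at h
        linarith
      · rintro rfl
        norm_num at h
        linarith
  rw [heq]
  exact (isCompact_Icc.prod isCompact_Icc).inter_right
    (isClosed_le (by fun_prop) (by fun_prop))

theorem continuousOn_zpow_mul_zpow_Δset (i j : ℤ) (s : ℝ) :
    ContinuousOn (fun z : ℝ × ℝ => z.1 ^ i * z.2 ^ j) (Δset s) :=
  (continuousOn_fst.zpow₀ i fun _ hz => Or.inl hz.1.ne').mul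
    (continuousOn_snd.zpow₀ j fun _ hz => Or.inl hz.2.1.ne')

theorem integrableOn_zpow_mul_zpow_Δset (i j : ℤ) {s : ℝ} (hs : 0 < s) :
    IntegrableOn (fun z : ℝ × ℝ => z.1 ^ i * z.2 ^ j) (Δset s) :=
  (continuousOn_zpow_mul_zpow_Δset i j s).integrableOn_compact (isCompact_Δset hs)

/-- A vertical slice of `Δset s` is empty or a closed interval whose endpoints lie on the
level curve. -/
theorem slice_Δset {s : ℝ} (hs : 0 < s) (x : ℝ) :
    {y | (x, y) ∈ Δset s} = ∅ ∨ ∃ a b : ℝ, 0 < x ∧ 0 < a ∧ a ≤ b ∧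
      x ^ 2 * a * (1 - x - a) = s ∧ x ^ 2 * b * (1 - x - b) = s ∧
      {y | (x, y) ∈ Δset s} = Icc a b := by
  rcases eq_empty_or_nonempty {y | (x, y) ∈ Δset s} with h | ⟨y₀, hx, hy₀, h₀⟩
  · exact Or.inl h
  right
  simp only at hx hy₀ h₀
  have hu : 0 < 1 - x - y₀ := pos_of_mul_pos_right (hs.trans_le h₀) (by positivity)
  set c := s / x ^ 2 with hc
  have hcs : s = x ^ 2 * c := by rw [hc]; field_simp
  have hc0 : 0 < c := by positivity
  have hx2 : 0 < x ^ 2 := by positivity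
  have hle (y : ℝ) : s ≤ x ^ 2 * y * (1 - x - y) ↔ c ≤ y * (1 - x - y) := by
    rw [hcs, mul_assoc, mul_le_mul_iff_right₀ hx2]
  have hD : 0 ≤ (1 - x) ^ 2 / 4 - c := by
    nlinarith [(hle y₀).1 h₀, sq_nonneg (y₀ - (1 - x) / 2)]
  set r := √((1 - x) ^ 2 / 4 - c) with hr
  have hr0 : 0 ≤ r := Real.sqrt_nonneg _
  have hr2 : r ^ 2 = (1 - x) ^ 2 / 4 - c := Real.sq_sqrt hD
  have ha : 0 < (1 - x) / 2 - r := by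
    have : r < (1 - x) / 2 := by
      apply lt_of_pow_lt_pow_left₀ 2 (by linarith)
      rw [hr2]
      linarith [div_pow (1 - x) 2 2]
    linarith
  refine ⟨(1 - x) / 2 - r, (1 - x) / 2 + r, hx, ha, by linarith, ?_, ?_, ?_⟩
  · rw [hcs]
    linear_combination (-x ^ 2) * hr2
  · rw [hcs]
    linear_combination (-x ^ 2) * hr2
  · ext y
    simp only [Δset, mem_ofPred_eq, mem_Icc, hle]
    constructor
    · rintro ⟨-, -, h⟩
      have := abs_le_of_sq_le_sq' (a := y - (1 - x) / 2) (b := r) (by nlinarith) hr0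
      constructor <;> linarith
    · rintro ⟨h1, h2⟩
      exact ⟨hx, by linarith, by nlinarith [mul_nonneg (sub_nonneg.2 h1) (sub_nonneg.2 h2)]⟩

/-- Integration by parts in `y` over `Δset s`; the boundary terms vanish. -/
theorem integral_Δset_deriv_snd_eq_zero (k l : ℤ) {s : ℝ} (hs : 0 < s) :
    ∫ z in Δset s, (((l : ℝ) + 1) * (z.1 ^ k * z.2 ^ l)
        * (z.1 ^ 2 * z.2 * (1 - z.1 - z.2) - s)
      + z.1 ^ k * z.2 ^ (l + 1) * (z.1 ^ 2 * (1 - z.1 - 2 * z.2))) = 0 := by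
  set f : ℝ × ℝ → ℝ := fun z => ((l : ℝ) + 1) * (z.1 ^ k * z.2 ^ l)
        * (z.1 ^ 2 * z.2 * (1 - z.1 - z.2) - s)
      + z.1 ^ k * z.2 ^ (l + 1) * (z.1 ^ 2 * (1 - z.1 - 2 * z.2)) with hf
  have hfc : ContinuousOn f (Δset s) := by
    have h1 := continuousOn_zpow_mul_zpow_Δset k l s
    have h2 := continuousOn_zpow_mul_zpow_Δset k (l + 1) s
    refine ((continuousOn_const.mul h1).mul (Continuous.continuousOn (by fun_prop))).add
      (h2.mul (Continuous.continuousOn (by fun_prop)))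
  have hm : MeasurableSet (Δset s) := (isCompact_Δset hs).measurableSet
  have hfi : IntegrableOn f (Δset s) := hfc.integrableOn_compact (isCompact_Δset hs)
  rw [← integral_indicator hm, Measure.volume_eq_prod,
    integral_prod _ ((integrable_indicator_iff hm).2 hfi)]
  refine integral_eq_zero_of_ae (Eventually.of_forall fun x => ?_)
  have hind : (fun y => (Δset s).indicator f (x, y)) =
      {y | (x, y) ∈ Δset s}.indicator fun y => f (x, y) := rfl
  simp only [Pi.zero_apply]
  rw [hind]
  rcases slice_Δset hs x with h | ⟨a, b, hx, ha, hab, hsa, hsb, h⟩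
  · simp [h]
  rw [h, integral_indicator measurableSet_Icc, integral_Icc_eq_integral_Ioc,
    ← intervalIntegral.integral_of_le hab]
  have hsub : ∀ y ∈ uIcc a b, 0 < y := fun y hy => by
    rw [uIcc_of_le hab] at hy
    exact ha.trans_le hy.1
  rw [intervalIntegral.integral_eq_sub_of_hasDerivAt
    (f := fun y => x ^ k * y ^ (l + 1) * (x ^ 2 * y * (1 - x - y) - s))]
  · simp [hsa, hsb]
  · intro y hy
    have hy0 := hsub y hy
    have h1 := (hasDerivAt_zpow (l + 1) y (Or.inl hy0.ne')).const_mul (x ^ k)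
    have h2 : HasDerivAt (fun y : ℝ => x ^ 2 * y * (1 - x - y) - s)
        (x ^ 2 * 1 * (1 - x - y) + x ^ 2 * y * (-1)) y :=
      ((((hasDerivAt_id y).const_mul (x ^ 2)).mul
        ((hasDerivAt_id y).const_sub (1 - x))).sub_const s)
    refine (h1.mul h2).congr_deriv ?_
    simp only [hf, add_sub_cancel_right]
    push_cast
    ring
  · refine ContinuousOn.intervalIntegrable (hfc.comp (by fun_prop) fun y hy => ?_)
    rw [uIcc_of_le hab, ← h] at hy
    exact hy

theorem Iab_combination_eq (k l : ℤ) {s : ℝ} (hs : 0 < s) :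
    Iab (k + 2) (l + 1) s - Iab (k + 3) (l + 1) s - 2 * Iab (k + 2) (l + 2) s =
      -((l : ℝ) + 1) * ∫ z in Δset s, z.1 ^ k * z.2 ^ l
        * (z.1 ^ 2 * z.2 * (1 - z.1 - z.2) - s) := by
  have hm : MeasurableSet (Δset s) := (isCompact_Δset hs).measurableSet
  have hA : IntegrableOn (fun z : ℝ × ℝ => z.1 ^ k * z.2 ^ l
      * (z.1 ^ 2 * z.2 * (1 - z.1 - z.2) - s)) (Δset s) :=
    ((continuousOn_zpow_mul_zpow_Δset k l s).mul
      (Continuous.continuousOn (by fun_prop))).integrableOn_compact (isCompact_Δset hs)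
  have hB : ∫ z in Δset s, z.1 ^ k * z.2 ^ (l + 1) * (z.1 ^ 2 * (1 - z.1 - 2 * z.2)) =
      Iab (k + 2) (l + 1) s - Iab (k + 3) (l + 1) s - 2 * Iab (k + 2) (l + 2) s := by
    have i1 := integrableOn_zpow_mul_zpow_Δset (k + 2) (l + 1) hs
    have i2 := integrableOn_zpow_mul_zpow_Δset (k + 3) (l + 1) hs
    have i3 := integrableOn_zpow_mul_zpow_Δset (k + 2) (l + 2) hs
    have h12 := integral_sub i1 i2
    have h123 := integral_sub (i1.sub i2) (i3.const_mul 2)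
    simp only [Pi.sub_apply] at h123
    simp only [Iab]
    rw [← integral_const_mul, ← h12, ← h123]
    refine setIntegral_congr_fun hm fun z hz => ?_
    have hx := hz.1.ne'
    have hy := hz.2.1.ne'
    simp only [zpow_add₀ hx, zpow_add₀ hy, zpow_one]
    norm_cast
    ring
  have hBi : IntegrableOn (fun z : ℝ × ℝ => z.1 ^ k * z.2 ^ (l + 1)
      * (z.1 ^ 2 * (1 - z.1 - 2 * z.2))) (Δset s) :=
    ((continuousOn_zpow_mul_zpow_Δset k (l + 1) s).mul
      (Continuous.continuousOn (by fun_prop))).integrableOn_compact (isCompact_Δset hs)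
  have h0 := integral_Δset_deriv_snd_eq_zero k l hs
  simp only [mul_assoc ((l : ℝ) + 1)] at h0
  rw [integral_add (hA.const_mul _) hBi, integral_const_mul, hB] at h0
  linarith

theorem volume_level_curve_eq_zero (t : ℝ) :
    volume {z : ℝ × ℝ | 0 < z.1 ∧ z.1 ^ 2 * z.2 * (1 - z.1 - z.2) = t} = 0 := by
  have hm : MeasurableSet {z : ℝ × ℝ | 0 < z.1 ∧ z.1 ^ 2 * z.2 * (1 - z.1 - z.2) = t} :=
    (measurableSet_lt measurable_const measurable_fst).inter
      (measurableSet_eq_fun (by fun_prop) measurable_const)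
  rw [Measure.volume_eq_prod, Measure.measure_prod_null hm]
  refine Eventually.of_forall fun x => ?_
  set d := (1 - x) ^ 2 / 4 - t / x ^ 2 with hd
  refine measure_mono_null (t := {(1 - x) / 2 + √d, (1 - x) / 2 - √d}) ?_
    ((Set.toFinite _).measure_zero _)
  rintro y ⟨hx, hy⟩
  simp only at hx hy
  have h : (y - (1 - x) / 2) ^ 2 = d := by
    rw [hd, ← hy]
    field_simp
    ring
  have h' : (y - (1 - x) / 2) ^ 2 = √d ^ 2 := by
    rw [Real.sq_sqrt (h ▸ sq_nonneg _), h]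
  rcases sq_eq_sq_iff_eq_or_eq_neg.1 h' with h | h
  · exact Or.inl (by linarith)
  · exact Or.inr (show y = _ by linarith)

theorem Δset_antitone : Antitone Δset := fun _ _ h _ hz => ⟨hz.1, hz.2.1, h.trans hz.2.2⟩

theorem setIntegral_Δset_eq_setIntegral_max (k l : ℤ) {r s : ℝ} (hr : 0 < r) (hrs : r ≤ s) :
    ∫ z in Δset s, z.1 ^ k * z.2 ^ l * (z.1 ^ 2 * z.2 * (1 - z.1 - z.2) - s) =
      ∫ z in Δset r, z.1 ^ k * z.2 ^ l * max (z.1 ^ 2 * z.2 * (1 - z.1 - z.2) - s) 0 := by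
  have hms := (isCompact_Δset (hr.trans_le hrs)).measurableSet
  have hmr := (isCompact_Δset hr).measurableSet
  rw [setIntegral_eq_of_subset_of_forall_sdiff_eq_zero hmr (Δset_antitone hrs)]
  · refine setIntegral_congr_fun hms fun z hz => ?_
    simp only [max_eq_left (sub_nonneg.2 hz.2.2)]
  · rintro z ⟨hz, hzs⟩
    have : z.1 ^ 2 * z.2 * (1 - z.1 - z.2) - s ≤ 0 := by
      by_contra! h
      exact hzs ⟨hz.1, hz.2.1, by linarith⟩
    rw [max_eq_right this, mul_zero]

theorem hasDerivAt_setIntegral_Δset (k l : ℤ) {t : ℝ} (ht : 0 < t) :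
    HasDerivAt (fun s => ∫ z in Δset s, z.1 ^ k * z.2 ^ l
      * (z.1 ^ 2 * z.2 * (1 - z.1 - z.2) - s)) (-Iab k l t) t := by
  have hr : 0 < t / 2 := half_pos ht
  have hmt := (isCompact_Δset ht).measurableSet
  have hmr := (isCompact_Δset hr).measurableSet
  have hint := integrableOn_zpow_mul_zpow_Δset k l hr
  have hF (s : ℝ) : IntegrableOn (fun z : ℝ × ℝ => z.1 ^ k * z.2 ^ l
      * max (z.1 ^ 2 * z.2 * (1 - z.1 - z.2) - s) 0) (Δset (t / 2)) :=
    ((continuousOn_zpow_mul_zpow_Δset k l _).mul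
      (Continuous.continuousOn (by fun_prop))).integrableOn_compact (isCompact_Δset hr)
  have hF' : IntegrableOn ((Δset t).indicator fun z : ℝ × ℝ => -(z.1 ^ k * z.2 ^ l))
      (Δset (t / 2)) := hint.neg.indicator hmt
  have key := hasDerivAt_integral_of_dominated_loc_of_lip
    (μ := volume.restrict (Δset (t / 2))) (x₀ := t) (s := univ)
    (F := fun s (z : ℝ × ℝ) => z.1 ^ k * z.2 ^ l
      * max (z.1 ^ 2 * z.2 * (1 - z.1 - z.2) - s) 0)
    (F' := (Δset t).indicator fun z : ℝ × ℝ => -(z.1 ^ k * z.2 ^ l))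
    (bound := fun z => z.1 ^ k * z.2 ^ l) univ_mem
    (Eventually.of_forall fun s => (hF s).aestronglyMeasurable) (hF t)
    hF'.aestronglyMeasurable
    (Eventually.of_forall fun z => by
      refine LipschitzWith.lipschitzOnWith (LipschitzWith.of_dist_le_mul fun a b => ?_)
      rw [Real.dist_eq, Real.dist_eq, ← mul_sub, abs_mul, Real.coe_nnabs]
      refine mul_le_mul_of_nonneg_left ?_ (abs_nonneg _)
      refine (abs_max_sub_max_le_abs _ _ _).trans_eq ?_
      rw [abs_sub_comm a b]
      ring_nf)
    hint
    (by
      have hne : ∀ᵐ z : ℝ × ℝ, ¬(0 < z.1 ∧ z.1 ^ 2 * z.2 * (1 - z.1 - z.2) = t) :=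
        compl_mem_ae_iff.2 (volume_level_curve_eq_zero t)
      filter_upwards [ae_restrict_of_ae hne, ae_restrict_mem hmr] with z hz hzr
      have hz' : z.1 ^ 2 * z.2 * (1 - z.1 - z.2) ≠ t := fun h => hz ⟨hzr.1, h⟩
      rcases hz'.lt_or_gt with h | h
      · rw [indicator_of_notMem fun hzt => h.not_ge hzt.2.2]
        refine (hasDerivAt_const t (0 : ℝ)).congr_of_eventuallyEq ?_
        filter_upwards [lt_mem_nhds h] with s hs
        simp [max_eq_right (sub_nonpos.2 (le_of_lt hs))]
      · rw [indicator_of_mem (show z ∈ Δset t from ⟨hzr.1, hzr.2.1, h.le⟩), ← mul_neg_one]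
        refine (((hasDerivAt_id t).const_sub (z.1 ^ 2 * z.2 * (1 - z.1 - z.2))).const_mul
          (z.1 ^ k * z.2 ^ l)).congr_of_eventuallyEq ?_
        filter_upwards [gt_mem_nhds h] with s hs
        rw [max_eq_left (sub_nonneg.2 (le_of_lt hs))]
        rfl)
  have hval : ∫ z in Δset (t / 2), (Δset t).indicator (fun z : ℝ × ℝ => -(z.1 ^ k * z.2 ^ l)) z
      = -Iab k l t := by
    rw [setIntegral_indicator hmt, inter_eq_right.2 (Δset_antitone (half_le_self ht.le)),
      integral_neg, Iab]
  rw [← hval]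
  refine key.2.congr_of_eventuallyEq ?_
  filter_upwards [lt_mem_nhds (half_lt_self ht)] with s hs
  exact setIntegral_Δset_eq_setIntegral_max k l hr (le_of_lt hs)

/-- fourth relation of Lemma 2.2 (Gelfand–Leray) specialized to `H`;
for `l = 0` it gives `(I_{k+2,1} - I_{k+3,1} - 2 I_{k+2,2})' = I_{k,0}`. -/
theorem abelian_integral_relation_four (k l : ℤ) (t : ℝ)
    (ht : t ∈ Set.Ioo (0 : ℝ) (1 / 64)) :
    HasDerivAt
      (fun s : ℝ =>
        Iab (k + 2) (l + 1) s - Iab (k + 3) (l + 1) s - 2 * Iab (k + 2) (l + 2) s)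
      (((l : ℝ) + 1) * Iab k l t) t := by
  have h := (hasDerivAt_setIntegral_Δset k l ht.1).const_mul (-((l : ℝ) + 1))
  rw [neg_mul_neg] at h
  refine h.congr_of_eventuallyEq ?_
  filter_upwards [lt_mem_nhds ht.1] with s hs
  exact Iab_combination_eq k l hs
end

section
/- For all integers k, l ∈ ℤ and all t ∈ (0, 1/64), the following two identities hold: (k+l+6)·I_{k+3,l+1}(t) = 2t·(l−k)·I_{k,l}(t) + (k+3)·I_{k+2,l+1}(t), and (k+l+6)·I_{k+2,l+2}(t) = −t·(3l−k+2)·I_{k,l}(t) + (l+2)·I_{k+2,l+1}(t). In particular, when k+l ≠ −6 the integrals I_{k+3,l+1} and I_{k+2,l+2} are expressed as μ₁(t)·I_{k,l}(t) + μ₂·I_{k+2,l+1}(t) with μ₁ a polynomial of degree at most 1 and μ₂ a constant. -/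
open MeasureTheory Set Filter

/-- The integral of a derivative over a compact interval vanishes when the primitive vanishes at
the boundary points of that interval. -/
theorem setIntegral_deriv_eq_zero_of_ordConnected {S : Set ℝ} (hS : IsCompact S)
    (hconn : S.OrdConnected) {F F' : ℝ → ℝ} (hF : ∀ x ∈ S, HasDerivAt F (F' x) x)
    (hF' : ContinuousOn F' S) (hbd : ∀ x ∈ S, S ∉ nhds x → F x = 0) :
    ∫ x in S, F' x = 0 := by
  rcases S.eq_empty_or_nonempty with rfl | hne
  · simp
  have ha := hS.sInf_mem hne
  have hb := hS.sSup_mem hne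
  have hab : sInf S ≤ sSup S := csInf_le hS.bddBelow hb
  have hIcc : S = Icc (sInf S) (sSup S) :=
    Subset.antisymm (subset_Icc_csInf_csSup hS.bddBelow hS.bddAbove) (hconn.out ha hb)
  have hFa : F (sInf S) = 0 := hbd _ ha fun h => by
    have hmem : S ∈ nhdsWithin _ (Iio (sInf S)) := nhdsWithin_le_nhds h
    obtain ⟨x, hx, hxS⟩ := Filter.nonempty_of_mem (inter_mem hmem self_mem_nhdsWithin)
    exact absurd (csInf_le hS.bddBelow hx) (not_le.2 hxS)
  have hFb : F (sSup S) = 0 := hbd _ hb fun h => by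
    have hmem : S ∈ nhdsWithin _ (Ioi (sSup S)) := nhdsWithin_le_nhds h
    obtain ⟨x, hx, hxS⟩ := Filter.nonempty_of_mem (inter_mem hmem self_mem_nhdsWithin)
    exact absurd (le_csSup hS.bddAbove hx) (not_le.2 hxS)
  have hu : uIcc (sInf S) (sSup S) = S := by rw [uIcc_of_le hab, ← hIcc]
  rw [hIcc, integral_Icc_eq_integral_Ioc, ← intervalIntegral.integral_of_le hab,
    intervalIntegral.integral_eq_sub_of_hasDerivAt (f := F) (fun x hx => hF x (hu ▸ hx))
      (ContinuousOn.intervalIntegrable (by rwa [hu])), hFa, hFb, sub_zero]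

/-- A function on a compact planar set that has a primitive in the second variable vanishing on
the boundary integrates to zero, provided that the slices of the set are intervals. -/
theorem setIntegral_deriv_snd_eq_zero {D : Set (ℝ × ℝ)} (hD : IsCompact D)
    (hconn : ∀ x, {y | (x, y) ∈ D}.OrdConnected) {F F' : ℝ × ℝ → ℝ}
    (hF : ∀ z ∈ D, HasDerivAt (fun y => F (z.1, y)) (F' z) z.2)
    (hF' : ContinuousOn F' D) (hbd : ∀ z ∈ D, D ∉ nhds z → F z = 0) :
    ∫ z in D, F' z = 0 := by
  have hint : Integrable (D.indicator F') (volume.prod volume) :=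
    (integrable_indicator_iff hD.measurableSet).2 (hF'.integrableOn_compact hD)
  rw [← integral_indicator hD.measurableSet, Measure.volume_eq_prod, integral_prod _ hint]
  refine (integral_congr_ae (.of_forall fun x => ?_)).trans (integral_zero _ _)
  have hcont : Continuous fun y : ℝ => (x, y) := by fun_prop
  have hslice : IsCompact {y | (x, y) ∈ D} :=
    (hD.image continuous_snd).of_isClosed_subset (hD.isClosed.preimage hcont)
      fun y hy => ⟨_, hy, rfl⟩
  have := setIntegral_deriv_eq_zero_of_ordConnected hslice (hconn x)
    (F := fun y => F (x, y)) (F' := fun y => F' (x, y)) (fun y hy => hF _ hy)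
    (hF'.comp hcont.continuousOn fun y hy => hy)
    fun y hy hn => hbd _ hy fun h => hn (hcont.continuousAt.preimage_mem_nhds h)
  rwa [← integral_indicator hslice.measurableSet] at this

/-- A function on a compact planar set that has a primitive in the first variable vanishing on
the boundary integrates to zero, provided that the slices of the set are intervals. -/
theorem setIntegral_deriv_fst_eq_zero {D : Set (ℝ × ℝ)} (hD : IsCompact D)
    (hconn : ∀ y, {x | (x, y) ∈ D}.OrdConnected) {F F' : ℝ × ℝ → ℝ}
    (hF : ∀ z ∈ D, HasDerivAt (fun x => F (x, z.2)) (F' z) z.1)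
    (hF' : ContinuousOn F' D) (hbd : ∀ z ∈ D, D ∉ nhds z → F z = 0) :
    ∫ z in D, F' z = 0 := by
  have hint : Integrable (D.indicator F') (volume.prod volume) :=
    (integrable_indicator_iff hD.measurableSet).2 (hF'.integrableOn_compact hD)
  rw [← integral_indicator hD.measurableSet, Measure.volume_eq_prod, integral_prod_symm _ hint]
  refine (integral_congr_ae (.of_forall fun y => ?_)).trans (integral_zero _ _)
  have hcont : Continuous fun x : ℝ => (x, y) := by fun_prop
  have hslice : IsCompact {x | (x, y) ∈ D} :=
    (hD.image continuous_fst).of_isClosed_subset (hD.isClosed.preimage hcont)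
      fun x hx => ⟨_, hx, rfl⟩
  have := setIntegral_deriv_eq_zero_of_ordConnected hslice (hconn y)
    (F := fun x => F (x, y)) (F' := fun x => F' (x, y)) (fun x hx => hF _ hx)
    (hF'.comp hcont.continuousOn fun x hx => hx)
    fun x hx hn => hbd _ hx fun h => hn (hcont.continuousAt.preimage_mem_nhds h)
  rwa [← integral_indicator hslice.measurableSet] at this

theorem add_lt_one_of_mem_Δset {t : ℝ} (ht : 0 < t) {z : ℝ × ℝ} (hz : z ∈ Δset t) :
    z.1 + z.2 < 1 := by
  obtain ⟨hx, hy, h⟩ := hz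
  have : 0 < 1 - z.1 - z.2 := pos_of_mul_pos_right (ht.trans_le h) (by positivity)
  linarith

theorem isCompact_Δset_s9 {t : ℝ} (ht : 0 < t) : IsCompact (Δset t) := by
  have heq : Δset t =
      {z : ℝ × ℝ | 0 ≤ z.1 ∧ 0 ≤ z.2 ∧ t ≤ z.1 ^ 2 * z.2 * (1 - z.1 - z.2)} := by
    ext z
    refine ⟨fun h => ⟨h.1.le, h.2.1.le, h.2.2⟩, fun ⟨hx, hy, h⟩ => ⟨?_, ?_, h⟩⟩
    · refine hx.lt_of_ne fun h0 => ?_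
      rw [← h0] at h
      linarith
    · refine hy.lt_of_ne fun h0 => ?_
      rw [← h0] at h
      linarith
  have hclosed : IsClosed (Δset t) := by
    rw [heq]
    exact (isClosed_le continuous_const continuous_fst).inter
      ((isClosed_le continuous_const continuous_snd).inter
        (isClosed_le (f := fun _ : ℝ × ℝ => t)
          (g := fun z : ℝ × ℝ => z.1 ^ 2 * z.2 * (1 - z.1 - z.2)) (by fun_prop) (by fun_prop)))
  refine (isCompact_Icc (a := ((0, 0) : ℝ × ℝ)) (b := (1, 1))).of_isClosed_subset hclosed
    fun z hz => ?_
  have := add_lt_one_of_mem_Δset ht hz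
  exact ⟨⟨hz.1.le, hz.2.1.le⟩, ⟨by linarith [hz.2.1], by linarith [hz.1]⟩⟩

theorem eq_of_mem_Δset_of_notMem_nhds {t : ℝ} {z : ℝ × ℝ} (hz : z ∈ Δset t)
    (hn : Δset t ∉ nhds z) : z.1 ^ 2 * z.2 * (1 - z.1 - z.2) = t := by
  by_contra hne
  have hlt := lt_of_le_of_ne hz.2.2 (Ne.symm hne)
  refine hn ?_
  filter_upwards [(isOpen_lt continuous_const continuous_fst).mem_nhds hz.1,
    (isOpen_lt continuous_const continuous_snd).mem_nhds hz.2.1,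
    (isOpen_lt (f := fun _ : ℝ × ℝ => t) (g := fun z : ℝ × ℝ => z.1 ^ 2 * z.2 * (1 - z.1 - z.2))
      (by fun_prop) (by fun_prop)).mem_nhds hlt] with w h1 h2 h3
  exact ⟨h1, h2, le_of_lt h3⟩

theorem ordConnected_Δset_snd (t x : ℝ) : {y | (x, y) ∈ Δset t}.OrdConnected := by
  refine ⟨fun a ⟨hx, ha, h1⟩ b ⟨_, hb, h2⟩ y ⟨hay, hyb⟩ => ⟨hx, ha.trans_le hay, ?_⟩⟩
  simp only at *
  have hx2 : 0 < x ^ 2 := by positivity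
  have : min (a * (1 - x - a)) (b * (1 - x - b)) ≤ y * (1 - x - y) := by
    rcases le_total (a + y) (1 - x) with h | h
    · exact min_le_of_left_le (by nlinarith)
    · exact min_le_of_right_le (by nlinarith)
  rw [mul_assoc] at *
  rcases min_le_iff.1 this with h | h
  · exact h1.trans (mul_le_mul_of_nonneg_left h hx2.le)
  · exact h2.trans (mul_le_mul_of_nonneg_left h hx2.le)

theorem ordConnected_Δset_fst (t y : ℝ) : {x | (x, y) ∈ Δset t}.OrdConnected := by
  refine ⟨fun a ⟨ha, hy, h1⟩ b ⟨hb, _, h2⟩ x ⟨hax, hxb⟩ => ⟨ha.trans_le hax, hy, ?_⟩⟩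
  simp only at *
  have : min (a ^ 2 * (1 - a - y)) (b ^ 2 * (1 - b - y)) ≤ x ^ 2 * (1 - x - y) := by
    rcases le_total (a ^ 2 + a * x + x ^ 2) ((1 - y) * (a + x)) with h | h
    · exact min_le_of_left_le (by nlinarith)
    · refine min_le_of_right_le ?_
      have hxa : 0 < x := ha.trans_le hax
      have : (1 - y) * (x + b) ≤ x ^ 2 + x * b + b ^ 2 := by
        have : (1 - y) * (a + x) * (x + b) ≤ (x ^ 2 + x * b + b ^ 2) * (a + x) := by
          have := mul_le_mul_of_nonneg_right h (by positivity : 0 ≤ x + b)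
          nlinarith [mul_nonneg (sub_nonneg.2 hxb) (mul_pos ha hb).le,
            mul_nonneg (sub_nonneg.2 hxb) (mul_pos ha hxa).le,
            mul_nonneg (sub_nonneg.2 hxb) (mul_pos hxa hb).le,
            mul_nonneg (sub_nonneg.2 (hax.trans hxb)) (mul_pos ha hb).le,
            mul_nonneg (sub_nonneg.2 (hax.trans hxb)) (mul_pos ha hxa).le,
            mul_nonneg (sub_nonneg.2 (hax.trans hxb)) (mul_pos hxa hb).le]
        have hpos : 0 < a + x := by positivity
        nlinarith
      nlinarith
  rcases min_le_iff.1 this with h | h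
  · nlinarith [mul_le_mul_of_nonneg_left h hy.le]
  · nlinarith [mul_le_mul_of_nonneg_left h hy.le]

theorem continuousOn_zpow_mul_zpow (t : ℝ) (i j : ℤ) :
    ContinuousOn (fun z : ℝ × ℝ => z.1 ^ i * z.2 ^ j) (Δset t) :=
  (continuousOn_fst.zpow₀ i fun _ hz => .inl hz.1.ne').mul
    (continuousOn_snd.zpow₀ j fun _ hz => .inl hz.2.1.ne')

/-- Linear combinations of four monomials integrate termwise over `Δset t`. -/
theorem setIntegral_Δset_combination {t : ℝ} (ht : 0 < t) (a b c d : ℝ) (k l : ℤ) :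
    ∫ z in Δset t, (a * (z.1 ^ (k + 2) * z.2 ^ (l + 1)) - b * (z.1 ^ (k + 3) * z.2 ^ (l + 1))
      - c * (z.1 ^ (k + 2) * z.2 ^ (l + 2)) - d * (z.1 ^ k * z.2 ^ l)) =
    a * Iab (k + 2) (l + 1) t - b * Iab (k + 3) (l + 1) t - c * Iab (k + 2) (l + 2) t
      - d * Iab k l t := by
  have hi (e : ℝ) (i j : ℤ) :
      Integrable (fun z : ℝ × ℝ => e * (z.1 ^ i * z.2 ^ j)) (volume.restrict (Δset t)) :=
    ((continuousOn_zpow_mul_zpow t i j).integrableOn_compact (isCompact_Δset_s9 ht)).const_mul e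
  rw [integral_sub (by exact ((hi _ _ _).sub (hi _ _ _)).sub (hi _ _ _)) (hi _ _ _),
    integral_sub (by exact (hi _ _ _).sub (hi _ _ _)) (hi _ _ _),
    integral_sub (hi _ _ _) (hi _ _ _)]
  simp only [integral_const_mul, Iab]

theorem Iab_relation_fst {t : ℝ} (ht : 0 < t) (k l : ℤ) :
    ((k : ℝ) + 3) * Iab (k + 2) (l + 1) t - ((k : ℝ) + 4) * Iab (k + 3) (l + 1) t
      - ((k : ℝ) + 3) * Iab (k + 2) (l + 2) t - t * ((k : ℝ) + 1) * Iab k l t = 0 := by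
  rw [← setIntegral_Δset_combination ht]
  refine setIntegral_deriv_fst_eq_zero (isCompact_Δset_s9 ht) (ordConnected_Δset_fst t)
    (F := fun z => z.1 ^ (k + 1) * z.2 ^ l * (z.1 ^ 2 * z.2 * (1 - z.1 - z.2) - t))
    (fun z hz => ?_) ?_ fun z hz hn => ?_
  · have hx : z.1 ≠ 0 := hz.1.ne'
    have hy : z.2 ≠ 0 := hz.2.1.ne'
    have h1 := (hasDerivAt_zpow (k + 1) z.1 (.inl hx)).mul_const (z.2 ^ l)
    have h2 := ((((hasDerivAt_id z.1).pow 2).mul_const z.2).mul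
      (((hasDerivAt_id z.1).const_sub 1).sub_const z.2)).sub_const t
    refine (h1.mul h2).congr_deriv ?_
    simp only [id, Pi.mul_apply, Pi.pow_apply, zpow_add₀ hx, zpow_add₀ hy, add_sub_cancel_right]
    norm_cast
    push_cast
    ring
  · have h := continuousOn_zpow_mul_zpow t
    exact ((((h _ _).const_mul _).sub ((h _ _).const_mul _)).sub ((h _ _).const_mul _)).sub
      ((h _ _).const_mul _)
  · simp only [eq_of_mem_Δset_of_notMem_nhds hz hn, sub_self, mul_zero]

theorem Iab_relation_snd {t : ℝ} (ht : 0 < t) (k l : ℤ) :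
    ((l : ℝ) + 2) * Iab (k + 2) (l + 1) t - ((l : ℝ) + 2) * Iab (k + 3) (l + 1) t
      - ((l : ℝ) + 3) * Iab (k + 2) (l + 2) t - t * ((l : ℝ) + 1) * Iab k l t = 0 := by
  rw [← setIntegral_Δset_combination ht]
  refine setIntegral_deriv_snd_eq_zero (isCompact_Δset_s9 ht) (ordConnected_Δset_snd t)
    (F := fun z => z.1 ^ k * z.2 ^ (l + 1) * (z.1 ^ 2 * z.2 * (1 - z.1 - z.2) - t))
    (fun z hz => ?_) ?_ fun z hz hn => ?_
  · have hx : z.1 ≠ 0 := hz.1.ne'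
    have hy : z.2 ≠ 0 := hz.2.1.ne'
    have h1 := (hasDerivAt_zpow (l + 1) z.2 (.inl hy)).const_mul (z.1 ^ k)
    have h2 := (((hasDerivAt_id z.2).const_mul (z.1 ^ 2)).mul
      ((hasDerivAt_id z.2).const_sub (1 - z.1))).sub_const t
    refine (h1.mul h2).congr_deriv ?_
    simp only [id, Pi.mul_apply, zpow_add₀ hx, zpow_add₀ hy, add_sub_cancel_right]
    norm_cast
    push_cast
    ring
  · have h := continuousOn_zpow_mul_zpow t
    exact ((((h _ _).const_mul _).sub ((h _ _).const_mul _)).sub ((h _ _).const_mul _)).sub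
      ((h _ _).const_mul _)
  · simp only [eq_of_mem_Δset_of_notMem_nhds hz hn, sub_self, mul_zero]

/-- `I_{k+3,l+1}` and `I_{k+2,l+2}` expressed through `I_{k,l}` and
`I_{k+2,l+1}` with coefficients affine in `t` (system (6) of the paper). -/
theorem abelian_integral_elimination (k l : ℤ) (t : ℝ)
    (ht : t ∈ Set.Ioo (0 : ℝ) (1 / 64)) :
    ((k : ℝ) + (l : ℝ) + 6) * Iab (k + 3) (l + 1) t =
        2 * t * ((l : ℝ) - (k : ℝ)) * Iab k l t + ((k : ℝ) + 3) * Iab (k + 2) (l + 1) t ∧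
    ((k : ℝ) + (l : ℝ) + 6) * Iab (k + 2) (l + 2) t =
        -(t * (3 * (l : ℝ) - (k : ℝ) + 2)) * Iab k l t +
          ((l : ℝ) + 2) * Iab (k + 2) (l + 1) t := by
  have h1 := Iab_relation_fst ht.1 k l
  have h2 := Iab_relation_snd ht.1 k l
  constructor
  · linear_combination ((k : ℝ) + 3) * h2 - ((l : ℝ) + 3) * h1
  · linear_combination ((l : ℝ) + 2) * h1 - ((k : ℝ) + 4) * h2
end

section
/- For all integers k, l ∈ ℤ and all t ∈ (0, 1/64), the Abelian integrals satisfy the linear relation (k − 2l − 1)·I_{k+2,l+1}(t) + (3l − k + 2)·I_{k+3,l+1}(t) + 2(l − k)·I_{k+2,l+2}(t) = 0. -/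
open MeasureTheory Set Filter

open scoped Topology

theorem integral_fderiv_mul_sub_fderiv_mul_eq_zero {F p q : ℝ × ℝ → ℝ}
    (hF : ContDiff ℝ 1 F) (hFc : HasCompactSupport F)
    (hp : ContDiff ℝ 1 p) (hq : ContDiff ℝ 1 q) {v w : ℝ × ℝ}
    (hpq : ∀ z, fderiv ℝ p z v = fderiv ℝ q z w) :
    ∫ z, (fderiv ℝ F z v * p z - fderiv ℝ F z w * q z) = 0 := by
  have hF' : ∀ u : ℝ × ℝ, Continuous fun z => fderiv ℝ F z u := fun u =>
    (hF.continuous_fderiv one_ne_zero).clm_apply continuous_const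
  have hFc' : ∀ u : ℝ × ℝ, HasCompactSupport fun z => fderiv ℝ F z u := fun u =>
    hFc.fderiv_apply (𝕜 := ℝ) u
  have hI : ∀ {r : ℝ × ℝ → ℝ} (_ : ContDiff ℝ 1 r) (u : ℝ × ℝ),
      Integrable (fun z => fderiv ℝ F z u * r z) := fun hr u =>
    ((hF' u).mul hr.continuous).integrable_of_hasCompactSupport ((hFc' u).mul_right)
  have hparts : ∀ {r : ℝ × ℝ → ℝ} (_ : ContDiff ℝ 1 r) (u : ℝ × ℝ),
      ∫ z, F z * fderiv ℝ r z u = - ∫ z, fderiv ℝ F z u * r z := fun hr u => by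
    refine integral_mul_fderiv_eq_neg_fderiv_mul_of_integrable (hI hr u) ?_ ?_
      (fun z _ => hF.differentiable one_ne_zero z) (fun z _ => hr.differentiable one_ne_zero z)
    · exact (hF.continuous.mul ((hr.continuous_fderiv one_ne_zero).clm_apply
        continuous_const)).integrable_of_hasCompactSupport hFc.mul_right
    · exact (hF.continuous.mul hr.continuous).integrable_of_hasCompactSupport hFc.mul_right
  have hpv := hparts hp v
  have hqw := hparts hq w
  simp only [hpq] at hpv
  rw [integral_sub (hI hp v) (hI hq w)]
  linarith

theorem isCompact_Δset_s10 {c : ℝ} (hc : 0 < c) : IsCompact (Δset c) := by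
  have heq : Δset c = {z : ℝ × ℝ | 0 ≤ z.1 ∧ 0 ≤ z.2 ∧ c ≤ z.1 ^ 2 * z.2 * (1 - z.1 - z.2)} := by
    ext z
    constructor
    · rintro ⟨h1, h2, h3⟩
      exact ⟨h1.le, h2.le, h3⟩
    · rintro ⟨h1, h2, h3⟩
      refine ⟨h1.lt_of_ne ?_, h2.lt_of_ne ?_, h3⟩
      · intro h
        rw [← h] at h3
        norm_num at h3
        linarith
      · intro h
        rw [← h] at h3
        norm_num at h3
        linarith
  have hclosed : IsClosed (Δset c) := by
    rw [heq]
    exact (isClosed_le continuous_const continuous_fst).inter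
      ((isClosed_le continuous_const continuous_snd).inter
        (isClosed_le continuous_const (by fun_prop :
          Continuous fun z : ℝ × ℝ => z.1 ^ 2 * z.2 * (1 - z.1 - z.2))))
  refine (isCompact_Icc (a := ((0 : ℝ), (0 : ℝ))) (b := (1, 1))).of_isClosed_subset hclosed ?_
  rintro z ⟨h1, h2, h3⟩
  have h4 : 0 < 1 - z.1 - z.2 := by
    by_contra! h
    nlinarith [mul_nonneg (mul_nonneg (sq_nonneg z.1) h2.le) (neg_nonneg.2 h)]
  exact ⟨⟨h1.le, h2.le⟩, ⟨by linarith, by linarith⟩⟩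

theorem integrableOn_Δset_zpow_mul_zpow {c : ℝ} (hc : 0 < c) (i j : ℤ) :
    IntegrableOn (fun z : ℝ × ℝ => z.1 ^ i * z.2 ^ j) (Δset c) := by
  refine ContinuousOn.integrableOn_compact (isCompact_Δset_s10 hc) ?_
  exact (continuousOn_fst.zpow₀ i fun z hz => Or.inl hz.1.ne').mul
    (continuousOn_snd.zpow₀ j fun z hz => Or.inl hz.2.1.ne')

/-- The Poisson bracket of `x ^ (k + 1) * y ^ (l + 1)` and `x ^ 2 * y * (1 - x - y)`. -/
noncomputable def bracket (k l : ℤ) (z : ℝ × ℝ) : ℝ :=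
  ((k : ℝ) - 2 * (l : ℝ) - 1) * (z.1 ^ (k + 2) * z.2 ^ (l + 1)) +
    (3 * (l : ℝ) - (k : ℝ) + 2) * (z.1 ^ (k + 3) * z.2 ^ (l + 1)) +
    2 * ((l : ℝ) - (k : ℝ)) * (z.1 ^ (k + 2) * z.2 ^ (l + 2))

theorem integrableOn_Δset_bracket {c : ℝ} (hc : 0 < c) (k l : ℤ) :
    IntegrableOn (bracket k l) (Δset c) :=
  (((integrableOn_Δset_zpow_mul_zpow hc _ _).const_mul _).add
    ((integrableOn_Δset_zpow_mul_zpow hc _ _).const_mul _)).add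
    ((integrableOn_Δset_zpow_mul_zpow hc _ _).const_mul _)

theorem setIntegral_bracket {t : ℝ} (ht : 0 < t) (k l : ℤ) :
    ∫ z in Δset t, bracket k l z =
      ((k : ℝ) - 2 * (l : ℝ) - 1) * Iab (k + 2) (l + 1) t +
      (3 * (l : ℝ) - (k : ℝ) + 2) * Iab (k + 3) (l + 1) t +
      2 * ((l : ℝ) - (k : ℝ)) * Iab (k + 2) (l + 2) t := by
  have h := fun (a : ℝ) i j => (integrableOn_Δset_zpow_mul_zpow ht i j).const_mul a
  unfold bracket Iab
  rw [integral_add ((h _ _ _).fun_add (h _ _ _)) (h _ _ _), integral_add (h _ _ _) (h _ _ _),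
    integral_const_mul, integral_const_mul, integral_const_mul]

theorem fderiv_monomial_mul_comp {ψ : ℝ → ℝ} (hψ : Differentiable ℝ ψ) (k l : ℤ) {z : ℝ × ℝ}
    (h1 : 0 < z.1) (h2 : 0 < z.2) :
    let G : ℝ × ℝ → ℝ := fun w =>
      w.1 ^ (k + 1) * w.2 ^ (l + 1) * ψ (w.1 ^ 2 * w.2 * (1 - w.1 - w.2))
    fderiv ℝ G z (1, 0) * (z.1 ^ 2 * (1 - z.1 - 2 * z.2)) -
      fderiv ℝ G z (0, 1) * (z.1 * z.2 * (2 - 3 * z.1 - 2 * z.2)) =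
      ψ (z.1 ^ 2 * z.2 * (1 - z.1 - z.2)) * bracket k l z := by
  intro G
  have hx : HasFDerivAt (fun w : ℝ × ℝ => w.1) (ContinuousLinearMap.fst ℝ ℝ ℝ) z := hasFDerivAt_fst
  have hy : HasFDerivAt (fun w : ℝ × ℝ => w.2) (ContinuousLinearMap.snd ℝ ℝ ℝ) z := hasFDerivAt_snd
  have hxk := (hasDerivAt_zpow (k + 1) z.1 (Or.inl h1.ne')).comp_hasFDerivAt z hx
  have hyl := (hasDerivAt_zpow (l + 1) z.2 (Or.inl h2.ne')).comp_hasFDerivAt z hy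
  have hH := ((hx.pow 2).mul hy).mul (((hasFDerivAt_const (1 : ℝ) z).sub hx).sub hy)
  have hψH := (hψ (z.1 ^ 2 * z.2 * (1 - z.1 - z.2))).hasDerivAt.comp_hasFDerivAt z hH
  have hG : HasFDerivAt G _ z := (hxk.mul hyl).mul hψH
  rw [hG.fderiv]
  have e1 : z.1 ^ (k + 1) = z.1 ^ k * z.1 := zpow_add_one₀ h1.ne' k
  have e2 : z.2 ^ (l + 1) = z.2 ^ l * z.2 := zpow_add_one₀ h2.ne' l
  have e3 : z.1 ^ (k + 2) = z.1 ^ k * z.1 ^ 2 := by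
    rw [zpow_add₀ h1.ne']; norm_cast
  have e4 : z.1 ^ (k + 3) = z.1 ^ k * z.1 ^ 3 := by
    rw [zpow_add₀ h1.ne']; norm_cast
  have e5 : z.2 ^ (l + 2) = z.2 ^ l * z.2 ^ 2 := by
    rw [zpow_add₀ h2.ne']; norm_cast
  simp [bracket, e1, e2, e3, e4, e5]
  ring

theorem setIntegral_comp_mul_bracket_eq_zero {ψ : ℝ → ℝ} (hψ : ContDiff ℝ 1 ψ) {c : ℝ}
    (hc : 0 < c) (hψc : ∀ s ≤ c, ψ s = 0) (k l : ℤ) :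
    ∫ z in Δset c, ψ (z.1 ^ 2 * z.2 * (1 - z.1 - z.2)) * bracket k l z = 0 := by
  set G : ℝ × ℝ → ℝ := fun w =>
    w.1 ^ (k + 1) * w.2 ^ (l + 1) * ψ (w.1 ^ 2 * w.2 * (1 - w.1 - w.2)) with hG
  set F : ℝ × ℝ → ℝ := (Δset c).indicator G with hF
  have hcpt := isCompact_Δset_s10 hc
  have hFG : ∀ z : ℝ × ℝ, 0 < z.1 → 0 < z.2 → F =ᶠ[𝓝 z] G := by
    intro z h1 h2
    filter_upwards [continuousAt_fst.eventually (lt_mem_nhds h1),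
      continuousAt_snd.eventually (lt_mem_nhds h2)] with w hw1 hw2
    by_cases hw : w ∈ Δset c
    · exact indicator_of_mem hw _
    · have hlt : w.1 ^ 2 * w.2 * (1 - w.1 - w.2) ≤ c := by
        by_contra! h
        exact hw ⟨hw1, hw2, h.le⟩
      rw [hF, indicator_of_notMem hw, hG]
      simp [hψc _ hlt]
  have hF0 : ∀ z ∉ Δset c, F =ᶠ[𝓝 z] fun _ => 0 := by
    intro z hz
    filter_upwards [hcpt.isClosed.isOpen_compl.mem_nhds hz] with w hw
    exact indicator_of_notMem hw _
  have hFsm : ContDiff ℝ 1 F := by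
    rw [contDiff_iff_contDiffAt]
    intro z
    by_cases hz : z ∈ Δset c
    · refine ContDiffAt.congr_of_eventuallyEq ?_ (hFG z hz.1 hz.2.1)
      have hx : ContDiffAt ℝ 1 (fun w : ℝ × ℝ => w.1 ^ (k + 1)) z :=
        (analyticAt_fst.fun_zpow hz.1.ne').contDiffAt
      have hy : ContDiffAt ℝ 1 (fun w : ℝ × ℝ => w.2 ^ (l + 1)) z :=
        (analyticAt_snd.fun_zpow hz.2.1.ne').contDiffAt
      exact (hx.mul hy).mul (hψ.comp (by fun_prop :
        ContDiff ℝ 1 fun w : ℝ × ℝ => w.1 ^ 2 * w.2 * (1 - w.1 - w.2))).contDiffAt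
    · exact contDiffAt_const.congr_of_eventuallyEq (hF0 z hz)
  have hFc : HasCompactSupport F :=
    HasCompactSupport.intro hcpt fun z hz => indicator_of_notMem hz _
  have key := integral_fderiv_mul_sub_fderiv_mul_eq_zero hFsm hFc
    (p := fun z => z.1 ^ 2 * (1 - z.1 - 2 * z.2))
    (q := fun z => z.1 * z.2 * (2 - 3 * z.1 - 2 * z.2)) (by fun_prop) (by fun_prop)
    (v := (1, 0)) (w := (0, 1)) (by
      intro z
      have hx : HasFDerivAt (fun w : ℝ × ℝ => w.1) (ContinuousLinearMap.fst ℝ ℝ ℝ) z :=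
        hasFDerivAt_fst
      have hy : HasFDerivAt (fun w : ℝ × ℝ => w.2) (ContinuousLinearMap.snd ℝ ℝ ℝ) z :=
        hasFDerivAt_snd
      have hp := (hx.pow 2).mul (((hasFDerivAt_const (1 : ℝ) z).sub hx).sub (hy.const_mul 2))
      have hq := (hx.mul hy).mul (((hasFDerivAt_const (2 : ℝ) z).sub (hx.const_mul 3)).sub
        (hy.const_mul 2))
      erw [hp.fderiv, hq.fderiv]
      simp
      ring)
  rw [← integral_indicator hcpt.measurableSet, ← key]
  refine integral_congr_ae (Eventually.of_forall fun z => ?_)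
  by_cases hz : z ∈ Δset c
  · simp only [indicator_of_mem hz, (hFG z hz.1 hz.2.1).fderiv_eq]
    exact (fderiv_monomial_mul_comp (hψ.differentiable one_ne_zero) k l hz.1 hz.2.1).symm
  · simp [indicator_of_notMem hz, (hF0 z hz).fderiv_eq]

theorem tendsto_smoothTransition_mul_add_one {r s t : ℝ} (hr : 0 < r) :
    Tendsto (fun n : ℕ => Real.smoothTransition (((n : ℝ) + 1) * r * (s - t) + 1)) atTop
      (𝓝 ((Ici t).indicator 1 s)) := by
  by_cases hs : t ≤ s
  · rw [indicator_of_mem (show s ∈ Ici t from hs)]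
    refine tendsto_const_nhds.congr fun n => (Real.smoothTransition.one_of_one_le ?_).symm
    have := mul_nonneg (mul_nonneg n.cast_add_one_pos.le hr.le) (sub_nonneg.2 hs)
    linarith
  · rw [indicator_of_notMem (show s ∉ Ici t from hs)]
    push Not at hs
    refine tendsto_const_nhds.congr' ?_
    have hpos : 0 < r * (t - s) := mul_pos hr (sub_pos.2 hs)
    obtain ⟨N, hN⟩ := exists_nat_gt (1 / (r * (t - s)))
    rw [div_lt_iff₀ hpos] at hN
    filter_upwards [eventually_ge_atTop N] with n hn
    refine (Real.smoothTransition.zero_of_nonpos ?_).symm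
    have : (N : ℝ) ≤ n := by exact_mod_cast hn
    nlinarith

theorem setIntegral_bracket_eq_zero {t : ℝ} (ht : 0 < t) (k l : ℤ) :
    ∫ z in Δset t, bracket k l z = 0 := by
  have hc : 0 < t / 2 := half_pos ht
  set ψ : ℕ → ℝ → ℝ := fun n s =>
    Real.smoothTransition (((n : ℝ) + 1) * (2 / t) * (s - t) + 1) with hψ
  have hψsm : ∀ n, ContDiff ℝ 1 (ψ n) := fun n =>
    (Real.smoothTransition.contDiff (n := 1)).comp (by fun_prop)
  have hψ0 : ∀ n, ∀ s ≤ t / 2, ψ n s = 0 := by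
    intro n s hs
    refine Real.smoothTransition.zero_of_nonpos ?_
    have h1 : 2 / t * (s - t) ≤ -1 := by
      rw [div_mul_eq_mul_div, div_le_iff₀ ht]
      linarith
    have h2 : (0 : ℝ) ≤ n := n.cast_nonneg
    nlinarith
  have hzero := fun n => setIntegral_comp_mul_bracket_eq_zero (hψsm n) hc (hψ0 n) k l
  have hint := integrableOn_Δset_bracket hc k l
  have hlim := tendsto_integral_of_dominated_convergence (μ := volume.restrict (Δset (t / 2)))
    (F := fun n z => ψ n (z.1 ^ 2 * z.2 * (1 - z.1 - z.2)) * bracket k l z)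
    (f := (Δset t).indicator (bracket k l)) (fun z => ‖bracket k l z‖)
    (fun n => (((hψsm n).continuous.comp (by fun_prop :
      Continuous fun z : ℝ × ℝ => z.1 ^ 2 * z.2 * (1 - z.1 - z.2))).aestronglyMeasurable).mul
      hint.aestronglyMeasurable) hint.norm
    (fun n => Eventually.of_forall fun z => by
      rw [norm_mul, Real.norm_of_nonneg (Real.smoothTransition.nonneg _)]
      exact mul_le_of_le_one_left (norm_nonneg _) (Real.smoothTransition.le_one _))
    ((ae_restrict_mem (isCompact_Δset_s10 hc).measurableSet).mono fun z hz => by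
      have h := (tendsto_smoothTransition_mul_add_one (r := 2 / t)
        (s := z.1 ^ 2 * z.2 * (1 - z.1 - z.2)) (t := t) (by positivity)).mul_const (bracket k l z)
      convert h using 2
      by_cases hzt : t ≤ z.1 ^ 2 * z.2 * (1 - z.1 - z.2)
      · rw [indicator_of_mem (show z ∈ Δset t from ⟨hz.1, hz.2.1, hzt⟩),
          indicator_of_mem (mem_Ici.2 hzt), Pi.one_apply, one_mul]
      · rw [indicator_of_notMem (fun h : z ∈ Δset t => hzt h.2.2),
          indicator_of_notMem (fun h => hzt (mem_Ici.1 h)), zero_mul])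
  simp only [hzero] at hlim
  have hsub : Δset t ⊆ Δset (t / 2) := fun z hz => ⟨hz.1, hz.2.1, by linarith [hz.2.2]⟩
  rw [setIntegral_indicator (isCompact_Δset_s10 ht).measurableSet, inter_eq_right.2 hsub] at hlim
  exact tendsto_nhds_unique hlim tendsto_const_nhds

/-- the linear relation (7) of the paper between `I_{k+2,l+1}`,
`I_{k+3,l+1}` and `I_{k+2,l+2}`. -/
theorem abelian_integral_linear_relation (k l : ℤ) (t : ℝ)
    (ht : t ∈ Set.Ioo (0 : ℝ) (1 / 64)) :
    ((k : ℝ) - 2 * (l : ℝ) - 1) * Iab (k + 2) (l + 1) t +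
      (3 * (l : ℝ) - (k : ℝ) + 2) * Iab (k + 3) (l + 1) t +
      2 * ((l : ℝ) - (k : ℝ)) * Iab (k + 2) (l + 2) t = 0 := by
  rw [← setIntegral_bracket ht.1]
  exact setIntegral_bracket_eq_zero ht.1 k l
end

section
/- For all t ∈ (0, 1/64): I_{1,0}(t) = 2·I_{2,0}(t) and I_{1,1}(t) = (1/2)·I_{2,0}(t). -/
open MeasureTheory Set Filter

/-- The length of the vertical slice of `Δset t` at abscissa `x`, multiplied by `x`. -/
noncomputable def sliceWeight (t x : ℝ) : ℝ :=
  (Ioo (0 : ℝ) 1).indicator (fun x => √((x * (1 - x)) ^ 2 - 4 * t)) x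

theorem sliceWeight_one_sub (t x : ℝ) : sliceWeight t (1 - x) = sliceWeight t x := by
  have h : 1 - x ∈ Ioo (0 : ℝ) 1 ↔ x ∈ Ioo (0 : ℝ) 1 := by
    simp only [mem_Ioo]; constructor <;> rintro ⟨h1, h2⟩ <;> constructor <;> linarith
  by_cases hx : x ∈ Ioo (0 : ℝ) 1
  · rw [sliceWeight, sliceWeight, indicator_of_mem (h.2 hx), indicator_of_mem hx]
    congr 1; ring
  · rw [sliceWeight, sliceWeight, indicator_of_notMem (mt h.1 hx), indicator_of_notMem hx]

theorem measurableSet_Δset (t : ℝ) : MeasurableSet (Δset t) := by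
  exact (measurableSet_lt measurable_const measurable_fst).inter
    ((measurableSet_lt measurable_const measurable_snd).inter
      (measurableSet_le (f := fun _ : ℝ × ℝ => t)
        (g := fun z : ℝ × ℝ => z.1 ^ 2 * z.2 * (1 - z.1 - z.2)) measurable_const (by fun_prop)))

theorem mem_Δset_bounds {t : ℝ} (ht : 0 < t) {z : ℝ × ℝ} (hz : z ∈ Δset t) :
    0 < z.1 ∧ 0 < z.2 ∧ z.1 + z.2 < 1 := by
  obtain ⟨h1, h2, h3⟩ := hz
  refine ⟨h1, h2, ?_⟩
  have h4 : 0 < z.1 ^ 2 * z.2 := by positivity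
  have h5 := pos_of_mul_pos_right (ht.trans_le h3) h4.le
  linarith

theorem integrableOn_Δset {t : ℝ} (ht : 0 < t) {f : ℝ × ℝ → ℝ} (hf : Continuous f) :
    IntegrableOn f (Δset t) := by
  refine (hf.continuousOn.integrableOn_compact
    (isCompact_Icc (a := ((0 : ℝ), (0 : ℝ))) (b := ((1 : ℝ), (1 : ℝ))))).mono_set ?_
  intro z hz
  obtain ⟨h1, h2, h3⟩ := mem_Δset_bounds ht hz
  exact ⟨⟨h1.le, h2.le⟩, ⟨by linarith, by linarith⟩⟩

theorem mem_Δset_iff {t x : ℝ} (ht : 0 < t) (hx : x ∈ Ioo (0 : ℝ) 1)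
    (hD : 0 ≤ (x * (1 - x)) ^ 2 - 4 * t) (y : ℝ) :
    (x, y) ∈ Δset t ↔
      y ∈ Icc ((1 - x) / 2 - √((x * (1 - x)) ^ 2 - 4 * t) / (2 * x))
        ((1 - x) / 2 + √((x * (1 - x)) ^ 2 - 4 * t) / (2 * x)) := by
  obtain ⟨hx0, hx1⟩ := hx
  have key : t ≤ x ^ 2 * y * (1 - x - y) ↔
      |2 * x * (y - (1 - x) / 2)| ≤ √((x * (1 - x)) ^ 2 - 4 * t) := by
    rw [Real.le_sqrt (abs_nonneg _) hD, sq_abs]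
    constructor <;> intro h <;> linarith
  have hIcc : y ∈ Icc ((1 - x) / 2 - √((x * (1 - x)) ^ 2 - 4 * t) / (2 * x))
        ((1 - x) / 2 + √((x * (1 - x)) ^ 2 - 4 * t) / (2 * x)) ↔
      |2 * x * (y - (1 - x) / 2)| ≤ √((x * (1 - x)) ^ 2 - 4 * t) := by
    rw [abs_mul, abs_of_pos (by positivity : 0 < 2 * x), ← le_div_iff₀' (by positivity), abs_le,
      mem_Icc]
    constructor <;> rintro ⟨h1, h2⟩ <;> constructor <;> linarith
  rw [hIcc, ← key]
  refine ⟨fun h => h.2.2, fun h => ⟨hx0, ?_, h⟩⟩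
  by_contra! hy
  have : 0 ≤ x ^ 2 * (-y * (1 - x - y)) :=
    mul_nonneg (sq_nonneg x) (mul_nonneg (by linarith) (by linarith))
  linarith

theorem notMem_Δset {t x : ℝ} (hD : (x * (1 - x)) ^ 2 - 4 * t < 0) (y : ℝ) :
    (x, y) ∉ Δset t := by
  rintro ⟨-, -, h⟩
  nlinarith [sq_nonneg (2 * x * (y - (1 - x) / 2))]

/-- Integration of an affine function of `y` over a vertical slice of `Δset t`. -/
theorem integral_slice {t : ℝ} (ht : 0 < t) (x a b : ℝ) :
    ∫ y, (Δset t).indicator (fun z => z.1 * (a + b * z.2)) (x, y) =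
      (a + b * ((1 - x) / 2)) * sliceWeight t x := by
  by_cases hx : x ∈ Ioo (0 : ℝ) 1
  swap
  · have h (y : ℝ) : (x, y) ∉ Δset t := fun h => by
      obtain ⟨h1, h2, h3⟩ := mem_Δset_bounds ht h
      exact hx ⟨h1, by simp only at h2 h3; linarith⟩
    simp [indicator_of_notMem (h _), sliceWeight, indicator_of_notMem hx]
  rw [sliceWeight, indicator_of_mem hx]
  rcases lt_or_ge ((x * (1 - x)) ^ 2 - 4 * t) 0 with hD | hD
  · simp [indicator_of_notMem (notMem_Δset hD _), Real.sqrt_eq_zero_of_nonpos hD.le]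
  have hx0 : x ≠ 0 := hx.1.ne'
  have hmem := mem_Δset_iff ht hx hD
  set w := √((x * (1 - x)) ^ 2 - 4 * t) with hw
  have hind : (fun y => (Δset t).indicator (fun z => z.1 * (a + b * z.2)) (x, y)) =
      (Icc ((1 - x) / 2 - w / (2 * x)) ((1 - x) / 2 + w / (2 * x))).indicator
        (fun y => x * (a + b * y)) := by
    ext y
    simp only [indicator, hmem y]
  have hw0 : 0 ≤ w / (2 * x) := div_nonneg (Real.sqrt_nonneg _) (by linarith [hx.1])
  rw [hind, integral_indicator measurableSet_Icc, integral_Icc_eq_integral_Ioc,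
    ← intervalIntegral.integral_of_le (by linarith), intervalIntegral.integral_const_mul,
    intervalIntegral.integral_add (by simp) (Continuous.intervalIntegrable (by fun_prop) _ _),
    intervalIntegral.integral_const_mul, integral_id, intervalIntegral.integral_const, smul_eq_mul]
  field_simp
  ring

theorem integrable_indicator_Δset {t : ℝ} (ht : 0 < t) {f : ℝ × ℝ → ℝ} (hf : Continuous f) :
    Integrable ((Δset t).indicator f) ((volume : Measure ℝ).prod volume) :=
  (integrable_indicator_iff (measurableSet_Δset t)).2 (integrableOn_Δset ht hf)

theorem integral_Δset {t : ℝ} (ht : 0 < t) {f : ℝ × ℝ → ℝ} (hf : Continuous f) :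
    ∫ z in Δset t, f z = ∫ x, ∫ y, (Δset t).indicator f (x, y) := by
  rw [← integral_indicator (measurableSet_Δset t), Measure.volume_eq_prod,
    integral_prod _ (integrable_indicator_Δset ht hf)]

theorem integrable_sliceWeight {t : ℝ} (ht : 0 < t) : Integrable (sliceWeight t) := by
  have h := (integrable_indicator_Δset ht
    (by fun_prop : Continuous fun z : ℝ × ℝ => z.1 * (1 + 0 * z.2))).integral_prod_left
  simp only [integral_slice ht] at h
  simpa only [zero_mul, add_zero, one_mul] using h

theorem integrable_mul_sliceWeight {t : ℝ} (ht : 0 < t) :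
    Integrable fun x => x * sliceWeight t x := by
  have h := (integrable_indicator_Δset ht
    (by fun_prop : Continuous fun z : ℝ × ℝ => z.1 * (0 + 1 * z.2))).integral_prod_left
  simp only [integral_slice ht] at h
  refine ((integrable_sliceWeight ht).sub (h.const_mul 2)).congr (ae_of_all _ fun x => ?_)
  simp only [Pi.sub_apply]
  ring

theorem integral_one_sub_mul_sliceWeight (t : ℝ) :
    ∫ x, (1 - x) * sliceWeight t x = ∫ x, x * sliceWeight t x := by
  rw [← integral_sub_left_eq_self (fun x => x * sliceWeight t x) volume 1]
  simp only [sliceWeight_one_sub]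

theorem Iab_one_zero {t : ℝ} (ht : 0 < t) : Iab 1 0 t = ∫ x, sliceWeight t x := by
  have h := integral_Δset ht (by fun_prop : Continuous fun z : ℝ × ℝ => z.1 * (1 + 0 * z.2))
  simp only [integral_slice ht] at h
  simpa [Iab] using h

theorem Iab_one_one {t : ℝ} (ht : 0 < t) :
    Iab 1 1 t = ∫ x, (1 - x) / 2 * sliceWeight t x := by
  have h := integral_Δset ht (by fun_prop : Continuous fun z : ℝ × ℝ => z.1 * (0 + 1 * z.2))
  simp only [integral_slice ht] at h
  simpa [Iab] using h

theorem Iab_two_zero {t : ℝ} (ht : 0 < t) : Iab 2 0 t = ∫ x, x * sliceWeight t x := by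
  have h := integral_Δset ht (by fun_prop : Continuous fun z : ℝ × ℝ => z.1 ^ 2)
  have hs (x : ℝ) : ∫ y, (Δset t).indicator (fun z => z.1 ^ 2) (x, y) = x * sliceWeight t x := by
    have hx := integral_slice ht x x 0
    rw [zero_mul, add_zero] at hx
    rw [← hx]
    congr 1
    ext y
    simp only [indicator]
    split_ifs <;> ring
  simp only [hs] at h
  rw [← h, Iab]
  congr 1
  ext z
  rw [zpow_zero, mul_one]
  norm_cast

/-- `I_{1,0} = 2 I_{2,0}` and `I_{1,1} = (1/2) I_{2,0}` on `(0,1/64)`. -/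
theorem abelian_integral_special_values (t : ℝ) (ht : t ∈ Set.Ioo (0 : ℝ) (1 / 64)) :
    Iab 1 0 t = 2 * Iab 2 0 t ∧ Iab 1 1 t = (1 / 2) * Iab 2 0 t := by
  have hrefl := integral_one_sub_mul_sliceWeight t
  rw [Iab_one_zero ht.1, Iab_two_zero ht.1, Iab_one_one ht.1]
  constructor
  · have hsub : ∫ x, (1 - x) * sliceWeight t x =
        (∫ x, sliceWeight t x) - ∫ x, x * sliceWeight t x := by
      rw [← integral_sub (integrable_sliceWeight ht.1) (integrable_mul_sliceWeight ht.1)]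
      simp only [sub_mul, one_mul]
    linarith
  · rw [← hrefl, ← integral_const_mul]
    congr 1
    ext x
    ring
end
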